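/- arXiv:1905.13176 — 3 statements merged into one kernel-verified Lean document; each statement's English description precedes it below -/
import Mathlib

section
/- For every constant c ≥ 1 there exists a constant C > 0, depending only on c, with the following property: if u : [0,1]² → ℝ is continuous on [0,1]², twice continuously differentiable on the open square (0,1)², and satisfies 1 ≤ Δu(x) ≤ c for all x ∈ (0,1)², then for every ε > 0 and every α > 0 the Lebesgue measure of the sublevel set satisfies |{x ∈ [0,1]² : |u(x)| ≤ ε}| ≤ C·( √ε + (2ε)^{α − 1/2} · ∫_{[0,1]²} ‖∇u(x)‖ / |u(x)|^α dx ), where the integral is interpreted as an extended-real-valued (possibly infinite) integral. -/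
open MeasureTheory

/-- The Laplacian `Δu(x) = ∂²u/∂x₁²(x) + ∂²u/∂x₂²(x)` in the plane. -/
noncomputable def laplacian (u : EuclideanSpace ℝ (Fin 2) → ℝ)
    (x : EuclideanSpace ℝ (Fin 2)) : ℝ :=
  ∑ i : Fin 2,
    fderiv ℝ (fun y => fderiv ℝ u y (EuclideanSpace.single i 1)) x (EuclideanSpace.single i 1)

/-- The closed unit square `[0,1]²`. -/
def unitSquare : Set (EuclideanSpace ℝ (Fin 2)) := {x | ∀ i, x i ∈ Set.Icc (0 : ℝ) 1}

/-- The open unit square `(0,1)²`. -/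
def openUnitSquare : Set (EuclideanSpace ℝ (Fin 2)) := {x | ∀ i, x i ∈ Set.Ioo (0 : ℝ) 1}

open Set Filter Topology

/-- The necessary second order condition at a local maximum. -/
theorem second_deriv_nonpos_of_isLocalMax {g g' : ℝ → ℝ} {t D : ℝ}
    (hg : ∀ᶠ x in 𝓝 t, HasDerivAt g (g' x) x) (hg' : HasDerivAt g' D t)
    (hmax : IsLocalMax g t) : D ≤ 0 := by
  by_contra! hD
  have h1 : deriv g =ᶠ[𝓝 t] g' := hg.mono fun x hx => hx.deriv
  have h2 : deriv (deriv g) t = D := by rw [h1.deriv_eq, hg'.deriv]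
  have h3 : IsLocalMin g t :=
    isLocalMin_of_deriv_deriv_pos (h2 ▸ hD) hmax.deriv_eq_zero hg.self_of_nhds.continuousAt
  have h4 : g =ᶠ[𝓝 t] fun _ => g t := by
    filter_upwards [hmax, h3] with x hx hx' using le_antisymm hx hx'
  have h5 : deriv g =ᶠ[𝓝 t] fun _ => 0 := by
    refine h4.deriv.trans (Eventually.of_forall fun x => by simp)
  have h6 : deriv (deriv g) t = 0 := by rw [h5.deriv_eq]; simp
  linarith

/-- A function passing from below `m₁` to above `m₂` has total variation at least `m₂ - m₁`
inside the region where its values lie strictly between these levels. -/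
theorem ofReal_sub_le_lintegral_abs_deriv {g g' : ℝ → ℝ} {J : Set ℝ} (hJo : IsOpen J)
    (hJ : J.OrdConnected) (hg : ∀ t ∈ J, HasDerivAt g (g' t) t) {b b' m₁ m₂ : ℝ}
    (hb : b ∈ J) (hb' : b' ∈ J) (h₁ : g b ≤ m₁) (h₂ : m₂ ≤ g b') :
    ENNReal.ofReal (m₂ - m₁) ≤
      ∫⁻ t in J ∩ {t | m₁ < g t ∧ g t < m₂}, ENNReal.ofReal |g' t| := by
  have hc : ContinuousOn g J := fun t ht => (hg t ht).continuousAt.continuousWithinAt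
  have hm : MeasurableSet (J ∩ {t | m₁ < g t ∧ g t < m₂}) :=
    (hc.isOpen_inter_preimage hJo (isOpen_Ioo (a := m₁) (b := m₂))).measurableSet
  have himage : Ioo m₁ m₂ ⊆ g '' (J ∩ {t | m₁ < g t ∧ g t < m₂}) := by
    intro y hy
    obtain ⟨t, ht, rfl⟩ := hJ.isPreconnected.intermediate_value hb hb' hc
      ⟨h₁.trans hy.1.le, hy.2.le.trans h₂⟩
    exact ⟨t, ⟨ht, hy⟩, rfl⟩
  calc ENNReal.ofReal (m₂ - m₁) = volume (Ioo m₁ m₂) := Real.volume_Ioo.symm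
    _ ≤ volume (g '' (J ∩ {t | m₁ < g t ∧ g t < m₂})) := measure_mono himage
    _ ≤ _ := by
      have := addHaar_image_le_lintegral_abs_det_fderiv volume hm
        (fun t ht => (hg t ht.1).hasDerivWithinAt.hasFDerivWithinAt)
      simpa only [ContinuousLinearMap.det_toSpanSingleton] using this

/-- Measure of the sublevel set in a block, if the set where `v > 2ε` has a large projection onto
the first axis. -/
theorem block_estimate_of_fst {v : ℝ × ℝ → ℝ} {G : ℝ × ℝ → ENNReal} {I J : Set ℝ} {ε h : ℝ}
    (hJ : MeasurableSet J) (hI : MeasurableSet I) (hε : 0 < ε) (hh : 0 < h) (hG : Measurable G)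
    (hv₁ : ∀ a ∈ I, ∀ b ∈ J, ∀ b' ∈ J, v (a, b) ≤ 3 / 2 * ε → 2 * ε < v (a, b') →
      ENNReal.ofReal (ε / 2) ≤ ∫⁻ t in J, G (a, t))
    (hv₂ : ∀ b ∈ J, ∀ a ∈ I, ∀ a' ∈ I, v (a, b) ≤ ε → 3 / 2 * ε < v (a', b) →
      ENNReal.ofReal (ε / 2) ≤ ∫⁻ t in I, G (t, b))
    (hIv : volume I ≤ ENNReal.ofReal (3 * h)) (hJv : volume J ≤ ENNReal.ofReal (3 * h))
    (hT : ENNReal.ofReal (h / 8) ≤ volume {a | a ∈ I ∧ ∃ b ∈ J, 2 * ε < v (a, b)}) :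
    ENNReal.ofReal (ε / 2) * volume {p | p ∈ I ×ˢ J ∧ |v p| ≤ ε} ≤
      ENNReal.ofReal (72 * h) * ∫⁻ p in I ×ˢ J, G p := by
  have hprod : (volume : Measure (ℝ × ℝ)).restrict (I ×ˢ J) =
      (volume.restrict I).prod (volume.restrict J) := by
    rw [Measure.prod_restrict, Measure.volume_eq_prod]
  by_cases hA : ∃ a ∈ I, ∀ b ∈ J, 3 / 2 * ε < v (a, b)
  · obtain ⟨a', ha', hA⟩ := hA
    have hsub : {p : ℝ × ℝ | p ∈ I ×ˢ J ∧ |v p| ≤ ε} ⊆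
        I ×ˢ ({b | ENNReal.ofReal (ε / 2) ≤ ∫⁻ t in I, G (t, b)} ∩ J) := by
      rintro ⟨a, b⟩ ⟨⟨ha, hb⟩, hab⟩
      exact ⟨ha, hv₂ b hb a ha a' ha' (le_of_abs_le hab) (hA b hb), hb⟩
    have hmarkov := mul_meas_ge_le_lintegral (μ := volume.restrict J)
      (f := fun b => ∫⁻ t in I, G (t, b)) hG.lintegral_prod_left' (ENNReal.ofReal (ε / 2))
    rw [Measure.restrict_apply' hJ, ← lintegral_prod_symm' _ hG, ← hprod] at hmarkov
    calc _ ≤ ENNReal.ofReal (ε / 2) * (ENNReal.ofReal (3 * h) *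
          volume ({b | ENNReal.ofReal (ε / 2) ≤ ∫⁻ t in I, G (t, b)} ∩ J)) := by
          gcongr
          refine (measure_mono hsub).trans ?_
          rw [Measure.volume_eq_prod, Measure.prod_prod]
          gcongr
      _ = ENNReal.ofReal (3 * h) * (ENNReal.ofReal (ε / 2) *
          volume ({b | ENNReal.ofReal (ε / 2) ≤ ∫⁻ t in I, G (t, b)} ∩ J)) := by ring
      _ ≤ ENNReal.ofReal (72 * h) * ∫⁻ p in I ×ˢ J, G p := by
          gcongr
          linarith
  · push Not at hA
    have hsub : {a | a ∈ I ∧ ∃ b ∈ J, 2 * ε < v (a, b)} ⊆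
        {a | ENNReal.ofReal (ε / 2) ≤ ∫⁻ t in J, G (a, t)} ∩ I := by
      rintro a ⟨ha, b', hb', hab⟩
      obtain ⟨b, hb, hab'⟩ := hA a ha
      exact ⟨hv₁ a ha b hb b' hb' hab' hab, ha⟩
    have hmarkov := mul_meas_ge_le_lintegral (μ := volume.restrict I)
      (f := fun a => ∫⁻ t in J, G (a, t)) hG.lintegral_prod_right' (ENNReal.ofReal (ε / 2))
    rw [Measure.restrict_apply' hI, ← lintegral_prod _ hG.aemeasurable, ← hprod] at hmarkov
    calc _ ≤ ENNReal.ofReal (ε / 2) * (ENNReal.ofReal (3 * h) * ENNReal.ofReal (3 * h)) := by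
          gcongr
          refine (measure_mono fun p hp => hp.1).trans ?_
          rw [Measure.volume_eq_prod, Measure.prod_prod]
          gcongr
      _ = ENNReal.ofReal (72 * h) * (ENNReal.ofReal (ε / 2) * ENNReal.ofReal (h / 8)) := by
          rw [← ENNReal.ofReal_mul (by positivity), ← ENNReal.ofReal_mul (by positivity),
            ← ENNReal.ofReal_mul (by positivity), ← ENNReal.ofReal_mul (by positivity)]
          congr 1
          ring
      _ ≤ _ := by
          gcongr
          refine le_trans ?_ hmarkov
          gcongr
          exact hT.trans (measure_mono hsub)

/-- Measure of the sublevel set in a block, if every square of radius between `h / 2` and `h`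
around some point of the central cell has a boundary point where `v > 2ε`. -/
theorem block_estimate {v : ℝ × ℝ → ℝ} {G : ℝ × ℝ → ENNReal} {p q a₀ b₀ ε h : ℝ}
    (hε : 0 < ε) (hh : 0 < h) (hG : Measurable G)
    (hv₁ : ∀ a ∈ Ioo p (p + 3 * h), ∀ b ∈ Ioo q (q + 3 * h), ∀ b' ∈ Ioo q (q + 3 * h),
      ∀ m₁ m₂ : ℝ, ε ≤ m₁ → m₂ ≤ 2 * ε → v (a, b) ≤ m₁ → m₂ < v (a, b') →
      ENNReal.ofReal (m₂ - m₁) ≤ ∫⁻ t in Ioo q (q + 3 * h), G (a, t))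
    (hv₂ : ∀ b ∈ Ioo q (q + 3 * h), ∀ a ∈ Ioo p (p + 3 * h), ∀ a' ∈ Ioo p (p + 3 * h),
      ∀ m₁ m₂ : ℝ, ε ≤ m₁ → m₂ ≤ 2 * ε → v (a, b) ≤ m₁ → m₂ < v (a', b) →
      ENNReal.ofReal (m₂ - m₁) ≤ ∫⁻ t in Ioo p (p + 3 * h), G (t, b))
    (ha₀ : a₀ ∈ Icc (p + h) (p + 2 * h)) (hb₀ : b₀ ∈ Icc (q + h) (q + 2 * h))
    (hspread : ∀ s ∈ Ioo (h / 2) h, ∃ y : ℝ × ℝ, |y.1 - a₀| ≤ s ∧ |y.2 - b₀| ≤ s ∧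
      (|y.1 - a₀| = s ∨ |y.2 - b₀| = s) ∧ 2 * ε < v y) :
    ENNReal.ofReal (ε / 2) *
        volume {x | x ∈ Ioo p (p + 3 * h) ×ˢ Ioo q (q + 3 * h) ∧ |v x| ≤ ε} ≤
      ENNReal.ofReal (72 * h) * ∫⁻ x in Ioo p (p + 3 * h) ×ˢ Ioo q (q + 3 * h), G x := by
  set I := Ioo p (p + 3 * h)
  set J := Ioo q (q + 3 * h)
  have hIv : volume I ≤ ENNReal.ofReal (3 * h) := by simp [I]
  have hJv : volume J ≤ ENNReal.ofReal (3 * h) := by simp [J]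
  have hreflect : ∀ (x : ℝ) (A : Set ℝ), volume ((fun s => x - s) ⁻¹' A) = volume A :=
    fun x A => (Measure.measurePreserving_sub_left volume x).measure_preimage_emb
      (MeasurableEquiv.subLeft x).measurableEmbedding A
  have hor : ENNReal.ofReal (h / 8) ≤ volume {a | a ∈ I ∧ ∃ b ∈ J, 2 * ε < v (a, b)} ∨
      ENNReal.ofReal (h / 8) ≤ volume {b | b ∈ J ∧ ∃ a ∈ I, 2 * ε < v (a, b)} := by
    by_contra! hcon
    set V := {a | a ∈ I ∧ ∃ b ∈ J, 2 * ε < v (a, b)}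
    set H := {b | b ∈ J ∧ ∃ a ∈ I, 2 * ε < v (a, b)}
    have hcover : Ioo (h / 2) h ⊆ (((fun s => a₀ + s) ⁻¹' V) ∪ ((fun s => a₀ - s) ⁻¹' V)) ∪
        (((fun s => b₀ + s) ⁻¹' H) ∪ ((fun s => b₀ - s) ⁻¹' H)) := by
      intro s hs
      obtain ⟨⟨y₁, y₂⟩, h₁, h₂, h₃, h₄⟩ := hspread s hs
      simp only at h₁ h₂ h₃
      have h₁' := abs_le.1 h₁
      have h₂' := abs_le.1 h₂
      have hs₂ := hs.2
      have hy₁ : y₁ ∈ I := ⟨by linarith [ha₀.1], by linarith [ha₀.2]⟩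
      have hy₂ : y₂ ∈ J := ⟨by linarith [hb₀.1], by linarith [hb₀.2]⟩
      have hyV : y₁ ∈ V := ⟨hy₁, y₂, hy₂, h₄⟩
      have hyH : y₂ ∈ H := ⟨hy₂, y₁, hy₁, h₄⟩
      rcases h₃ with h₃ | h₃
      · left
        rcases abs_choice (y₁ - a₀) with h | h
        · left
          rw [mem_preimage, show a₀ + s = y₁ by linarith]
          exact hyV
        · right
          rw [mem_preimage, show a₀ - s = y₁ by linarith]
          exact hyV
      · right
        rcases abs_choice (y₂ - b₀) with h | h
        · left
          rw [mem_preimage, show b₀ + s = y₂ by linarith]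
          exact hyH
        · right
          rw [mem_preimage, show b₀ - s = y₂ by linarith]
          exact hyH
    have hle : ENNReal.ofReal (h / 2) ≤ (volume V + volume V) + (volume H + volume H) := by
      calc ENNReal.ofReal (h / 2) = volume (Ioo (h / 2) h) := by
            rw [Real.volume_Ioo]
            congr 1
            ring
        _ ≤ _ := measure_mono hcover
        _ ≤ _ := measure_union_le _ _
        _ ≤ _ := add_le_add (measure_union_le _ _) (measure_union_le _ _)
        _ = _ := by rw [hreflect, hreflect, measure_preimage_add, measure_preimage_add]
    have hlt : (volume V + volume V) + (volume H + volume H) < ENNReal.ofReal (h / 2) := by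
      calc _ < (ENNReal.ofReal (h / 8) + ENNReal.ofReal (h / 8)) +
            (ENNReal.ofReal (h / 8) + ENNReal.ofReal (h / 8)) :=
            ENNReal.add_lt_add (ENNReal.add_lt_add hcon.1 hcon.1)
              (ENNReal.add_lt_add hcon.2 hcon.2)
        _ = _ := by
            rw [← ENNReal.ofReal_add (by positivity) (by positivity),
              ← ENNReal.ofReal_add (by positivity) (by positivity)]
            congr 1
            ring
    exact absurd hle (not_le.2 hlt)
  have e₁ : 2 * ε - 3 / 2 * ε = ε / 2 := by ring
  have e₂ : 3 / 2 * ε - ε = ε / 2 := by ring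
  rcases hor with hT | hT
  · refine block_estimate_of_fst measurableSet_Ioo measurableSet_Ioo hε hh hG ?_ ?_ hIv hJv hT
    · intro a ha b hb b' hb' h₁ h₂
      exact e₁ ▸ hv₁ a ha b hb b' hb' _ _ (by linarith) le_rfl h₁ h₂
    · intro b hb a ha a' ha' h₁ h₂
      exact e₂ ▸ hv₂ b hb a ha a' ha' _ _ le_rfl (by linarith) h₁ h₂
  · have key := block_estimate_of_fst (v := v ∘ Prod.swap) (G := G ∘ Prod.swap) (I := J) (J := I)
      measurableSet_Ioo measurableSet_Ioo hε hh (hG.comp measurable_swap)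
      (fun b hb a ha a' ha' h₁ h₂ => e₁ ▸ hv₂ b hb a ha a' ha' _ _ (by linarith) le_rfl h₁ h₂)
      (fun a ha b hb b' hb' h₁ h₂ => e₂ ▸ hv₁ a ha b hb b' hb' _ _ le_rfl (by linarith) h₁ h₂)
      hJv hIv hT
    have hswap : MeasurePreserving (Prod.swap : ℝ × ℝ → ℝ × ℝ) volume volume :=
      Measure.measurePreserving_swap
    have hemb : MeasurableEmbedding (Prod.swap : ℝ × ℝ → ℝ × ℝ) :=
      MeasurableEquiv.prodComm.measurableEmbedding
    have h₁ : {x : ℝ × ℝ | x ∈ J ×ˢ I ∧ |(v ∘ Prod.swap) x| ≤ ε} =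
        Prod.swap ⁻¹' {x | x ∈ I ×ˢ J ∧ |v x| ≤ ε} := by
      ext ⟨a, b⟩
      simp [and_comm]
    have h₂ : J ×ˢ I = Prod.swap ⁻¹' (I ×ˢ J) := by
      ext ⟨a, b⟩
      simp [and_comm]
    rw [h₁, hswap.measure_preimage_emb hemb, h₂] at key
    simpa only [Function.comp_apply, hswap.setLIntegral_comp_preimage_emb hemb] using key

/-- The grid cell of side length `h` with index `k`. -/
def gridCell (h : ℝ) (k : ℤ × ℤ) : Set (ℝ × ℝ) := {x | ⌊x.1 / h⌋ = k.1 ∧ ⌊x.2 / h⌋ = k.2}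

theorem measurableSet_gridCell (h : ℝ) (k : ℤ × ℤ) : MeasurableSet (gridCell h k) := by
  have h₁ : Measurable fun x : ℝ × ℝ => ⌊x.1 / h⌋ := (measurable_fst.div_const h).floor
  have h₂ : Measurable fun x : ℝ × ℝ => ⌊x.2 / h⌋ := (measurable_snd.div_const h).floor
  exact (h₁ (measurableSet_singleton k.1)).inter (h₂ (measurableSet_singleton k.2))

theorem tsum_lintegral_gridCell (h : ℝ) (G : ℝ × ℝ → ENNReal) :
    ∑' k, ∫⁻ x in gridCell h k, G x = ∫⁻ x, G x := by
  have hun : ⋃ k, gridCell h k = univ :=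
    eq_univ_of_forall fun x => mem_iUnion.2 ⟨(⌊x.1 / h⌋, ⌊x.2 / h⌋), rfl, rfl⟩
  rw [← setLIntegral_univ G, ← hun, lintegral_iUnion (measurableSet_gridCell h)]
  intro k l hkl
  rw [Function.onFun, Set.disjoint_left]
  rintro x ⟨h₁, h₂⟩ ⟨h₃, h₄⟩
  exact hkl (Prod.ext (h₁.symm.trans h₃) (h₂.symm.trans h₄))

/-- The blocks of `3 × 3` grid cells cover each point at most nine times. -/
theorem tsum_lintegral_block_le {h : ℝ} (hh : 0 < h) (G : ℝ × ℝ → ENNReal) :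
    ∑' k : ℤ × ℤ, ∫⁻ x in Ioo ((k.1 - 1) * h) ((k.1 - 1) * h + 3 * h) ×ˢ
        Ioo ((k.2 - 1) * h) ((k.2 - 1) * h + 3 * h), G x ≤ 9 * ∫⁻ x, G x := by
  let D : Finset (ℤ × ℤ) := Finset.Icc (-1) 1 ×ˢ Finset.Icc (-1) 1
  have hfloor : ∀ (n : ℤ) (t : ℝ), t ∈ Ioo ((n - 1) * h) ((n - 1) * h + 3 * h) →
      ⌊t / h⌋ - n ∈ Finset.Icc (-1 : ℤ) 1 := by
    intro n t ht
    have h₁ : n - 1 ≤ ⌊t / h⌋ := by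
      rw [Int.le_floor, le_div_iff₀ hh]
      push_cast
      exact ht.1.le
    have h₂ : ⌊t / h⌋ < n + 2 := by
      rw [Int.floor_lt, div_lt_iff₀ hh]
      push_cast
      linarith [ht.2]
    rw [Finset.mem_Icc]
    omega
  have hblock : ∀ k : ℤ × ℤ, Ioo ((k.1 - 1) * h) ((k.1 - 1) * h + 3 * h) ×ˢ
        Ioo ((k.2 - 1) * h) ((k.2 - 1) * h + 3 * h) ⊆ ⋃ d : D, gridCell h (k + d) := by
    rintro k ⟨a, b⟩ ⟨ha, hb⟩
    exact mem_iUnion.2 ⟨⟨(⌊a / h⌋ - k.1, ⌊b / h⌋ - k.2),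
      Finset.mem_product.2 ⟨hfloor _ _ ha, hfloor _ _ hb⟩⟩, by simp [gridCell]⟩
  calc _ ≤ ∑' k : ℤ × ℤ, ∑ d ∈ D, ∫⁻ x in gridCell h (k + d), G x := by
        refine ENNReal.tsum_le_tsum fun k => (lintegral_mono_set (hblock k)).trans ?_
        refine (lintegral_iUnion_le (fun d : D => gridCell h (k + d)) G).trans_eq ?_
        rw [tsum_fintype]
        exact Finset.sum_coe_sort D fun d => ∫⁻ x in gridCell h (k + d), G x
    _ = ∑ d ∈ D, ∑' k : ℤ × ℤ, ∫⁻ x in gridCell h (k + d), G x :=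
        Summable.tsum_finsetSum fun _ _ => ENNReal.summable
    _ = ∑ d ∈ D, ∫⁻ x, G x := by
        refine Finset.sum_congr rfl fun d _ => ?_
        rw [← tsum_lintegral_gridCell h G]
        exact (Equiv.addRight d).tsum_eq fun k => ∫⁻ x in gridCell h k, G x
    _ = 9 * ∫⁻ x, G x := by
        rw [Finset.sum_const, show D.card = 9 from rfl, nsmul_eq_mul]
        norm_num

/-- Sublevel estimate in coordinates, from lower bounds for the integral of `G` on segments and
from the growth of `v` along the boundaries of squares. -/
theorem volume_sublevel_le {v : ℝ × ℝ → ℝ} {G : ℝ × ℝ → ENNReal} {ε : ℝ} (hε : 0 < ε)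
    (hG : Measurable G)
    (hv₁ : ∀ a ∈ Ioo (0 : ℝ) 1, ∀ q q' : ℝ, Ioo q q' ⊆ Ioo 0 1 → ∀ b ∈ Ioo q q', ∀ b' ∈ Ioo q q',
      ∀ m₁ m₂ : ℝ, ε ≤ m₁ → m₂ ≤ 2 * ε → v (a, b) ≤ m₁ → m₂ < v (a, b') →
      ENNReal.ofReal (m₂ - m₁) ≤ ∫⁻ t in Ioo q q', G (a, t))
    (hv₂ : ∀ b ∈ Ioo (0 : ℝ) 1, ∀ p p' : ℝ, Ioo p p' ⊆ Ioo 0 1 → ∀ a ∈ Ioo p p', ∀ a' ∈ Ioo p p',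
      ∀ m₁ m₂ : ℝ, ε ≤ m₁ → m₂ ≤ 2 * ε → v (a, b) ≤ m₁ → m₂ < v (a', b) →
      ENNReal.ofReal (m₂ - m₁) ≤ ∫⁻ t in Ioo p p', G (t, b))
    (hspread : ∀ a₀ b₀ s : ℝ, 0 < s → Icc (a₀ - s) (a₀ + s) ⊆ Ioo 0 1 →
      Icc (b₀ - s) (b₀ + s) ⊆ Ioo 0 1 → ∃ y : ℝ × ℝ, |y.1 - a₀| ≤ s ∧ |y.2 - b₀| ≤ s ∧
      (|y.1 - a₀| = s ∨ |y.2 - b₀| = s) ∧ v (a₀, b₀) + s ^ 2 / 8 ≤ v y) :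
    volume {x | x ∈ Icc (0 : ℝ) 1 ×ˢ Icc (0 : ℝ) 1 ∧ |v x| ≤ ε} ≤
      ENNReal.ofReal (80 * √ε) + ENNReal.ofReal (12960 / √ε) * ∫⁻ x, G x := by
  have hr : 0 < √ε := Real.sqrt_pos.2 hε
  have hrr : √ε * √ε = ε := Real.mul_self_sqrt hε.le
  obtain ⟨h, hh_def⟩ : ∃ h, h = 10 * √ε := ⟨_, rfl⟩
  have hh : 0 < h := by rw [hh_def]; positivity
  have hh_sq : h ^ 2 = 100 * ε := by rw [hh_def]; linear_combination 100 * hrr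
  set N := {x : ℝ × ℝ | x ∈ Icc (2 * h) (1 - 2 * h) ×ˢ Icc (2 * h) (1 - 2 * h) ∧ |v x| ≤ ε} with hN
  have hcell : ∀ k : ℤ × ℤ, ENNReal.ofReal (ε / 2) * volume (N ∩ gridCell h k) ≤
      ENNReal.ofReal (72 * h) * ∫⁻ x in Ioo ((k.1 - 1) * h) ((k.1 - 1) * h + 3 * h) ×ˢ
        Ioo ((k.2 - 1) * h) ((k.2 - 1) * h + 3 * h), G x := by
    intro k
    rcases (N ∩ gridCell h k).eq_empty_or_nonempty with hempty | ⟨⟨a₀, b₀⟩, hx, hxk⟩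
    · simp [hempty]
    have hcoord : ∀ {n : ℤ} {t : ℝ}, ⌊t / h⌋ = n →
        t ∈ Ico ((n - 1) * h + h) ((n - 1) * h + 2 * h) := by
      intro n t ht
      rw [Int.floor_eq_iff, le_div_iff₀ hh, div_lt_iff₀ hh] at ht
      constructor <;> linarith [ht.1, ht.2]
    have ha₀ := hcoord hxk.1
    have hb₀ := hcoord hxk.2
    obtain ⟨⟨ha, hb⟩, hvx⟩ := hx
    simp only at ha hb ha₀ hb₀
    have hI : Ioo ((k.1 - 1) * h) ((k.1 - 1) * h + 3 * h) ⊆ Ioo 0 1 := by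
      refine Ioo_subset_Ioo ?_ ?_ <;> linarith [ha.1, ha.2, ha₀.1, ha₀.2]
    have hJ : Ioo ((k.2 - 1) * h) ((k.2 - 1) * h + 3 * h) ⊆ Ioo 0 1 := by
      refine Ioo_subset_Ioo ?_ ?_ <;> linarith [hb.1, hb.2, hb₀.1, hb₀.2]
    refine le_trans ?_ (block_estimate (v := v) hε hh hG (fun a ha => hv₁ a (hI ha) _ _ hJ)
      (fun b hb => hv₂ b (hJ hb) _ _ hI) ⟨ha₀.1, ha₀.2.le⟩ ⟨hb₀.1, hb₀.2.le⟩ ?_)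
    · gcongr
      rintro ⟨a, b⟩ ⟨hab, habk⟩
      have ha' := hcoord habk.1
      have hb' := hcoord habk.2
      refine ⟨⟨⟨?_, ?_⟩, ⟨?_, ?_⟩⟩, hab.2⟩ <;> simp only at ha' hb' ⊢ <;>
        linarith [ha'.1, ha'.2, hb'.1, hb'.2]
    · intro s hs
      have hs₁ := hs.1
      have hs₂ := hs.2
      obtain ⟨y, h₁, h₂, h₃, h₄⟩ := hspread a₀ b₀ s (by linarith)
        (Icc_subset_Ioo (by linarith [ha.1]) (by linarith [ha.2]))
        (Icc_subset_Ioo (by linarith [hb.1]) (by linarith [hb.2]))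
      refine ⟨y, h₁, h₂, h₃, ?_⟩
      have := (abs_le.1 hvx).1
      nlinarith
  have hsum : ENNReal.ofReal (ε / 2) * volume N ≤
      ENNReal.ofReal (72 * h) * (9 * ∫⁻ x, G x) := by
    have hcover : N ⊆ ⋃ k, N ∩ gridCell h k := fun x hx =>
      mem_iUnion.2 ⟨(⌊x.1 / h⌋, ⌊x.2 / h⌋), hx, rfl, rfl⟩
    refine (mul_le_mul_right ((measure_mono hcover).trans (measure_iUnion_le _)) _).trans ?_
    rw [← ENNReal.tsum_mul_left]
    refine (ENNReal.tsum_le_tsum hcell).trans ?_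
    rw [ENNReal.tsum_mul_left]
    exact mul_le_mul_right (tsum_lintegral_block_le hh G) _
  have hNle : volume N ≤ ENNReal.ofReal (12960 / √ε) * ∫⁻ x, G x := by
    calc volume N = ENNReal.ofReal (2 / ε) * (ENNReal.ofReal (ε / 2) * volume N) := by
          rw [← mul_assoc, ← ENNReal.ofReal_mul (by positivity),
            show 2 / ε * (ε / 2) = 1 by field_simp, ENNReal.ofReal_one, one_mul]
      _ ≤ ENNReal.ofReal (2 / ε) * (ENNReal.ofReal (72 * h) * (9 * ∫⁻ x, G x)) := by gcongr
      _ = _ := by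
          rw [← ENNReal.ofReal_ofNat 9, ← mul_assoc, ← mul_assoc,
            ← ENNReal.ofReal_mul (by positivity), ← ENNReal.ofReal_mul (by positivity)]
          congr 2
          rw [hh_def]
          field_simp
          linear_combination 12960 * hrr
  have hcover : {x : ℝ × ℝ | x ∈ Icc (0 : ℝ) 1 ×ˢ Icc (0 : ℝ) 1 ∧ |v x| ≤ ε} ⊆
      ((Icc 0 (2 * h) ×ˢ Icc 0 1 ∪ Icc (1 - 2 * h) 1 ×ˢ Icc 0 1) ∪
      (Icc 0 1 ×ˢ Icc 0 (2 * h) ∪ Icc 0 1 ×ˢ Icc (1 - 2 * h) 1)) ∪ N := by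
    rintro ⟨a, b⟩ ⟨⟨ha, hb⟩, hab⟩
    simp only [mem_union, mem_prod, mem_Icc, hN, mem_ofPred_eq] at ha hb ⊢
    grind
  have hstrip₁ : volume (Icc 0 (2 * h) ×ˢ Icc (0 : ℝ) 1) = ENNReal.ofReal (2 * h) := by
    rw [Measure.volume_eq_prod, Measure.prod_prod]; simp
  have hstrip₂ : volume (Icc (1 - 2 * h) 1 ×ˢ Icc (0 : ℝ) 1) = ENNReal.ofReal (2 * h) := by
    rw [Measure.volume_eq_prod, Measure.prod_prod]; simp
  have hstrip₃ : volume (Icc (0 : ℝ) 1 ×ˢ Icc 0 (2 * h)) = ENNReal.ofReal (2 * h) := by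
    rw [Measure.volume_eq_prod, Measure.prod_prod]; simp
  have hstrip₄ : volume (Icc (0 : ℝ) 1 ×ˢ Icc (1 - 2 * h) 1) = ENNReal.ofReal (2 * h) := by
    rw [Measure.volume_eq_prod, Measure.prod_prod]; simp
  refine (measure_mono hcover).trans ((measure_union_le _ _).trans (add_le_add ?_ hNle))
  calc _ ≤ _ := measure_union_le _ _
    _ ≤ _ := add_le_add (measure_union_le _ _) (measure_union_le _ _)
    _ = ENNReal.ofReal (80 * √ε) := by
      rw [hstrip₁, hstrip₂, hstrip₃, hstrip₄, ← ENNReal.ofReal_add (by positivity) (by positivity),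
        ← ENNReal.ofReal_add (by positivity) (by positivity), hh_def]
      congr 1
      ring

theorem isOpen_openUnitSquare : IsOpen openUnitSquare := by
  have : openUnitSquare = ⋂ i, {x : EuclideanSpace ℝ (Fin 2) | x i ∈ Ioo (0 : ℝ) 1} := by
    ext x
    simp [openUnitSquare]
  rw [this]
  exact isOpen_iInter_of_finite fun i =>
    isOpen_Ioo.preimage (EuclideanSpace.proj (𝕜 := ℝ) i).continuous

theorem hasDerivAt_add_smul_single {u : EuclideanSpace ℝ (Fin 2) → ℝ}
    {x : EuclideanSpace ℝ (Fin 2)} {i : Fin 2} {t : ℝ}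
    (hu : DifferentiableAt ℝ u (x + t • EuclideanSpace.single i 1)) :
    HasDerivAt (fun t : ℝ => u (x + t • EuclideanSpace.single i 1))
      (fderiv ℝ u (x + t • EuclideanSpace.single i 1) (EuclideanSpace.single i 1)) t := by
  have h : HasDerivAt (fun t : ℝ => x + t • EuclideanSpace.single i (1 : ℝ))
      (EuclideanSpace.single i 1) t := by
    simpa using ((hasDerivAt_id t).smul_const (EuclideanSpace.single i (1 : ℝ))).const_add x
  exact hu.hasFDerivAt.comp_hasDerivAt t h

/-- A function with Laplacian at least one grows quadratically from the center of a square to some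
point of its boundary. -/
theorem exists_boundary_point_growth {u : EuclideanSpace ℝ (Fin 2) → ℝ}
    (hu : ContDiffOn ℝ 2 u openUnitSquare) (hlap : ∀ x ∈ openUnitSquare, 1 ≤ laplacian u x)
    {x₀ : EuclideanSpace ℝ (Fin 2)} {s : ℝ} (hs : 0 < s)
    (hsub : ∀ i, Icc (x₀ i - s) (x₀ i + s) ⊆ Ioo 0 1) :
    ∃ y : EuclideanSpace ℝ (Fin 2), (∀ i, |y i - x₀ i| ≤ s) ∧ (∃ i, |y i - x₀ i| = s) ∧
      u x₀ + s ^ 2 / 8 ≤ u y := by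
  set K : Set (EuclideanSpace ℝ (Fin 2)) := {x | ∀ i, x i ∈ Icc (x₀ i - s) (x₀ i + s)} with hK
  have hKsub : K ⊆ openUnitSquare := fun x hx i => hsub i (hx i)
  have hKc : IsCompact K := by
    have h : K = (EuclideanSpace.equiv (Fin 2) ℝ).toHomeomorph ⁻¹'
        univ.pi fun i => Icc (x₀ i - s) (x₀ i + s) := by
      ext x
      simp only [hK, mem_preimage, mem_univ_pi]
      rfl
    rw [h, Homeomorph.isCompact_preimage]
    exact isCompact_univ_pi fun i => isCompact_Icc
  set w : EuclideanSpace ℝ (Fin 2) → ℝ := fun x => u x - ∑ i, (x i - x₀ i) ^ 2 / 8 with hw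
  have hwc : ContinuousOn w K := by
    refine (hu.continuousOn.mono hKsub).sub (Continuous.continuousOn ?_)
    fun_prop
  have hx₀ : x₀ ∈ K := fun i => ⟨by linarith, by linarith⟩
  obtain ⟨y, hyK, hymax⟩ := hKc.exists_isMaxOn ⟨x₀, hx₀⟩ hwc
  have hys : ∀ i, |y i - x₀ i| ≤ s := fun i =>
    abs_le.2 ⟨by linarith [(hyK i).1], by linarith [(hyK i).2]⟩
  have hyb : ∃ i, |y i - x₀ i| = s := by
    by_contra! hne
    have hlt : ∀ i, |y i - x₀ i| < s := fun i => (hys i).lt_of_ne (hne i)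
    have hyΩ := hKsub hyK
    have hlap_y := hlap y hyΩ
    rw [laplacian, Fin.sum_univ_two] at hlap_y
    obtain ⟨i, hi⟩ : ∃ i : Fin 2, 1 / 2 ≤ fderiv ℝ (fun y => fderiv ℝ u y
        (EuclideanSpace.single i 1)) y (EuclideanSpace.single i 1) := by
      by_contra! hcon
      linarith [hcon 0, hcon 1]
    have hΩ : ∀ᶠ x in 𝓝 y, x ∈ openUnitSquare := isOpen_openUnitSquare.mem_nhds hyΩ
    have hline : Tendsto (fun t : ℝ => y + t • EuclideanSpace.single i (1 : ℝ)) (𝓝 0) (𝓝 y) := by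
      have : Continuous fun t : ℝ => y + t • EuclideanSpace.single i (1 : ℝ) := by fun_prop
      simpa using this.tendsto 0
    have hKnhds : ∀ᶠ x in 𝓝 y, x ∈ K := by
      refine eventually_all.2 fun j => ?_
      have hcj : ContinuousAt (fun x : EuclideanSpace ℝ (Fin 2) => x j) y :=
        (EuclideanSpace.proj (𝕜 := ℝ) j).continuous.continuousAt
      have := abs_lt.1 (hlt j)
      exact hcj (Icc_mem_nhds (by linarith) (by linarith))
    have hdiff : ∀ x ∈ openUnitSquare, DifferentiableAt ℝ u x := fun x hx =>
      (hu.contDiffAt (isOpen_openUnitSquare.mem_nhds hx)).differentiableAt (by norm_num)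
    have hdiff' : DifferentiableAt ℝ (fun y => fderiv ℝ u y (EuclideanSpace.single i 1)) y := by
      have h := ((hu.contDiffAt (isOpen_openUnitSquare.mem_nhds hyΩ)).fderiv_right
        (m := 1) (by norm_num)).differentiableAt (by norm_num)
      exact h.clm_apply (differentiableAt_const _)
    set c : ℝ := y i - x₀ i
    have hwline : ∀ t : ℝ, w (y + t • EuclideanSpace.single i 1) =
        u (y + t • EuclideanSpace.single i 1) - (c + t) ^ 2 / 8 -
          ((∑ j, (y j - x₀ j) ^ 2 / 8) - c ^ 2 / 8) := by
      intro t
      fin_cases i <;> simp [w, c, Fin.sum_univ_two] <;> ring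
    have hD := second_deriv_nonpos_of_isLocalMax (t := 0)
      (g := fun t : ℝ => w (y + t • EuclideanSpace.single i 1))
      (g' := fun t : ℝ => fderiv ℝ u (y + t • EuclideanSpace.single i 1)
        (EuclideanSpace.single i 1) - (c + t) / 4)
      (D := fderiv ℝ (fun y => fderiv ℝ u y (EuclideanSpace.single i 1)) y
        (EuclideanSpace.single i 1) - 1 / 4) ?_ ?_ ?_
    · linarith
    · filter_upwards [hline.eventually hΩ] with t ht
      simp only [hwline]
      have h₁ := hasDerivAt_add_smul_single (hdiff _ ht)
      have h₂ : HasDerivAt (fun t : ℝ => (c + t) ^ 2 / 8) ((c + t) / 4) t := by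
        refine ((((hasDerivAt_id t).const_add c).pow 2).div_const 8).congr_deriv ?_
        simp only [id_eq]
        ring
      exact (h₁.sub h₂).sub_const _
    · have h₁ := hasDerivAt_add_smul_single (x := y) (i := i) (t := 0)
        (u := fun y => fderiv ℝ u y (EuclideanSpace.single i 1)) (by simpa using hdiff')
      simp only [zero_smul, add_zero] at h₁
      exact h₁.sub (((hasDerivAt_id (0 : ℝ)).const_add c).div_const 4)
    · filter_upwards [hline.eventually hKnhds] with t ht
      simpa using hymax ht
  refine ⟨y, hys, hyb, ?_⟩
  obtain ⟨i, hi⟩ := hyb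
  have hle : w x₀ ≤ w y := hymax hx₀
  have hsq : s ^ 2 / 8 ≤ ∑ j, (y j - x₀ j) ^ 2 / 8 := by
    rw [← hi, sq_abs]
    exact Finset.single_le_sum (f := fun j => (y j - x₀ j) ^ 2 / 8)
      (fun j _ => by positivity) (Finset.mem_univ i)
  simp only [hw, sub_self, ne_eq, OfNat.ofNat_ne_zero, not_false_eq_true, zero_pow, zero_div,
    Finset.sum_const_zero, sub_zero] at hle
  linarith

theorem norm_gradient_eq_norm_fderiv {E : Type*} [NormedAddCommGroup E] [InnerProductSpace ℝ E]
    [CompleteSpace E] (f : E → ℝ) (x : E) : ‖gradient f x‖ = ‖fderiv ℝ f x‖ := by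
  rw [gradient, LinearIsometryEquiv.norm_map]

theorem measurePreserving_euclideanPlane :
    MeasurePreserving (fun p : ℝ × ℝ => (!₂[p.1, p.2] : EuclideanSpace ℝ (Fin 2)))
      volume volume :=
  (PiLp.volume_preserving_toLp (Fin 2)).comp (volume_preserving_finTwoArrow ℝ).symm

theorem measurableEmbedding_euclideanPlane :
    MeasurableEmbedding (fun p : ℝ × ℝ => (!₂[p.1, p.2] : EuclideanSpace ℝ (Fin 2))) :=
  (MeasurableEquiv.finTwoArrow.symm.trans
    (MeasurableEquiv.toLp 2 (Fin 2 → ℝ))).measurableEmbedding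

/-- The sublevel estimate in terms of the integral of the gradient between two levels. -/
theorem volume_sublevel_le_lintegral_fderiv {u : EuclideanSpace ℝ (Fin 2) → ℝ}
    (hu : ContDiffOn ℝ 2 u openUnitSquare) (hlap : ∀ x ∈ openUnitSquare, 1 ≤ laplacian u x)
    {ε : ℝ} (hε : 0 < ε) :
    volume {x ∈ unitSquare | |u x| ≤ ε} ≤ ENNReal.ofReal (80 * √ε) +
      ENNReal.ofReal (12960 / √ε) *
        ∫⁻ x in openUnitSquare ∩ {x | ε < u x ∧ u x < 2 * ε}, ENNReal.ofReal ‖fderiv ℝ u x‖ := by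
  set e : ℝ × ℝ → EuclideanSpace ℝ (Fin 2) := fun p => !₂[p.1, p.2]
  have he : MeasurePreserving e volume volume := measurePreserving_euclideanPlane
  have hemb : MeasurableEmbedding e := measurableEmbedding_euclideanPlane
  have heΩ : ∀ {a b : ℝ}, a ∈ Ioo (0 : ℝ) 1 → b ∈ Ioo (0 : ℝ) 1 → e (a, b) ∈ openUnitSquare := by
    intro a b ha hb i
    fin_cases i
    exacts [ha, hb]
  set W : Set (EuclideanSpace ℝ (Fin 2)) := openUnitSquare ∩ {x | ε < u x ∧ u x < 2 * ε}
  have hW : MeasurableSet W := (hu.continuousOn.isOpen_inter_preimage isOpen_openUnitSquare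
    (isOpen_Ioo (a := ε) (b := 2 * ε))).measurableSet
  set G : EuclideanSpace ℝ (Fin 2) → ENNReal :=
    W.indicator fun x => ENNReal.ofReal ‖fderiv ℝ u x‖ with hG_def
  have hG : Measurable G := (measurable_fderiv ℝ u).norm.ennreal_ofReal.indicator hW
  have hdiff : ∀ x ∈ openUnitSquare, DifferentiableAt ℝ u x := fun x hx =>
    (hu.contDiffAt (isOpen_openUnitSquare.mem_nhds hx)).differentiableAt (by norm_num)
  have hpartial : ∀ x (i : Fin 2), ENNReal.ofReal |fderiv ℝ u x (EuclideanSpace.single i 1)| ≤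
      ENNReal.ofReal ‖fderiv ℝ u x‖ := by
    intro x i
    refine ENNReal.ofReal_le_ofReal ?_
    simpa using (fderiv ℝ u x).le_opNorm (EuclideanSpace.single i 1)
  have hfst : ∀ a b : ℝ, e (a, b) = e (0, b) + a • EuclideanSpace.single 0 1 := by
    intro a b
    ext i
    fin_cases i <;> simp [e]
  have hsnd : ∀ a b : ℝ, e (a, b) = e (a, 0) + b • EuclideanSpace.single 1 1 := by
    intro a b
    ext i
    fin_cases i <;> simp [e]
  have hd₁ : ∀ a b : ℝ, e (a, b) ∈ openUnitSquare → HasDerivAt (fun a => u (e (a, b)))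
      (fderiv ℝ u (e (a, b)) (EuclideanSpace.single 0 1)) a := by
    intro a b hab
    have := hdiff _ hab
    rw [hfst] at this
    rw [show (fun a => u (e (a, b))) = fun a => u (e (0, b) + a • EuclideanSpace.single 0 1) from
      funext fun a => by rw [hfst a b], hfst a b]
    exact hasDerivAt_add_smul_single this
  have hd₂ : ∀ a b : ℝ, e (a, b) ∈ openUnitSquare → HasDerivAt (fun b => u (e (a, b)))
      (fderiv ℝ u (e (a, b)) (EuclideanSpace.single 1 1)) b := by
    intro a b hab
    have := hdiff _ hab
    rw [hsnd] at this
    rw [show (fun b => u (e (a, b))) = fun b => u (e (a, 0) + b • EuclideanSpace.single 1 1) from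
      funext fun b => by rw [hsnd a b], hsnd a b]
    exact hasDerivAt_add_smul_single this
  have hGe : Measurable fun p => G (e p) := hG.comp he.measurable
  have key := volume_sublevel_le (v := fun p => u (e p)) (G := fun p => G (e p)) hε hGe ?_ ?_ ?_
  · have h₁ : {x : ℝ × ℝ | x ∈ Icc (0 : ℝ) 1 ×ˢ Icc (0 : ℝ) 1 ∧ |u (e x)| ≤ ε} =
        e ⁻¹' {x ∈ unitSquare | |u x| ≤ ε} := by
      ext ⟨a, b⟩
      simp only [unitSquare, e, Fin.forall_fin_two, mem_prod, mem_preimage, mem_ofPred_eq]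
      rfl
    rw [h₁, he.measure_preimage_emb hemb, he.lintegral_comp_emb hemb,
      lintegral_indicator hW] at key
    exact key
  · intro a ha q q' hqq b hb b' hb' m₁ m₂ hm₁ hm₂ h₁ h₂
    refine (ofReal_sub_le_lintegral_abs_deriv isOpen_Ioo ordConnected_Ioo
      (fun t ht => hd₂ a t (heΩ ha (hqq ht))) hb hb' h₁ h₂.le).trans ?_
    refine (setLIntegral_mono (hGe.comp measurable_prodMk_left) fun t ht => ?_).trans
      (lintegral_mono_set inter_subset_left)
    have hW_mem : e (a, t) ∈ W :=
      ⟨heΩ ha (hqq ht.1), hm₁.trans_lt ht.2.1, ht.2.2.trans_le hm₂⟩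
    simp only [hG_def, Function.comp_apply, indicator_of_mem hW_mem]
    exact hpartial _ _
  · intro b hb p p' hpp a ha a' ha' m₁ m₂ hm₁ hm₂ h₁ h₂
    refine (ofReal_sub_le_lintegral_abs_deriv isOpen_Ioo ordConnected_Ioo
      (fun t ht => hd₁ t b (heΩ (hpp ht) hb)) ha ha' h₁ h₂.le).trans ?_
    refine (setLIntegral_mono (hGe.comp measurable_prodMk_right) fun t ht => ?_).trans
      (lintegral_mono_set inter_subset_left)
    have hW_mem : e (t, b) ∈ W :=
      ⟨heΩ (hpp ht.1) hb, hm₁.trans_lt ht.2.1, ht.2.2.trans_le hm₂⟩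
    simp only [hG_def, Function.comp_apply, indicator_of_mem hW_mem]
    exact hpartial _ _
  · intro a b s hs ha hb
    obtain ⟨y, hy₁, hy₂, hy₃⟩ := exists_boundary_point_growth hu hlap (x₀ := e (a, b)) hs
      (fun i => by fin_cases i; exacts [ha, hb])
    have hy : e (y 0, y 1) = y := by
      ext i
      fin_cases i <;> simp [e]
    exact ⟨(y 0, y 1), hy₁ 0, hy₁ 1, Fin.exists_fin_two.1 hy₂, by simpa only [hy] using hy₃⟩

/-- Main theorem: for `u : [0,1]² → ℝ` with `1 ≤ Δu ≤ c`, one has for all `ε, α > 0`: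
`|{x : |u(x)| ≤ ε}| ≤ C (√ε + (2ε)^{α - 1/2} ∫ |∇u|/|u|^α)`. -/
theorem sublevel_estimate_laplacian (c : ℝ) (hc : 1 ≤ c) :
    ∃ C : ℝ, 0 < C ∧
      ∀ u : EuclideanSpace ℝ (Fin 2) → ℝ,
        ContinuousOn u unitSquare → ContDiffOn ℝ 2 u openUnitSquare →
        (∀ x ∈ openUnitSquare, 1 ≤ laplacian u x ∧ laplacian u x ≤ c) →
        ∀ ε : ℝ, 0 < ε → ∀ α : ℝ, 0 < α →
          volume {x ∈ unitSquare | |u x| ≤ ε} ≤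
            ENNReal.ofReal C *
              (ENNReal.ofReal (Real.sqrt ε) +
                ENNReal.ofReal ((2 * ε) ^ (α - 1 / 2)) *
                  ∫⁻ x in unitSquare, ENNReal.ofReal (‖gradient u x‖ / |u x| ^ α)) := by
  refine ⟨25920, by norm_num, fun u _ hu hlap ε hε α hα => ?_⟩
  refine (volume_sublevel_le_lintegral_fderiv hu (fun x hx => (hlap x hx).1) hε).trans ?_
  have hr : 0 < √ε := Real.sqrt_pos.2 hε
  have hW : MeasurableSet (openUnitSquare ∩ {x | ε < u x ∧ u x < 2 * ε}) :=
    (hu.continuousOn.isOpen_inter_preimage isOpen_openUnitSquare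
      (isOpen_Ioo (a := ε) (b := 2 * ε))).measurableSet
  have hint : ∫⁻ x in openUnitSquare ∩ {x | ε < u x ∧ u x < 2 * ε},
      ENNReal.ofReal ‖fderiv ℝ u x‖ ≤ ENNReal.ofReal ((2 * ε) ^ α) *
        ∫⁻ x in unitSquare, ENNReal.ofReal (‖gradient u x‖ / |u x| ^ α) := by
    rw [← lintegral_const_mul' _ _ ENNReal.ofReal_ne_top]
    refine (setLIntegral_mono' hW fun x hx => ?_).trans
      (lintegral_mono_set fun x hx i => Ioo_subset_Icc_self (hx.1 i))
    have hux : 0 < u x := hε.trans hx.2.1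
    rw [← ENNReal.ofReal_mul (by positivity), norm_gradient_eq_norm_fderiv, abs_of_pos hux]
    refine ENNReal.ofReal_le_ofReal ?_
    have hpow : 0 < u x ^ α := Real.rpow_pos_of_pos hux α
    rw [← mul_div_assoc, le_div_iff₀ hpow, mul_comm]
    gcongr
    exact hx.2.2.le
  have hconst : 12960 / √ε * (2 * ε) ^ α ≤ 25920 * (2 * ε) ^ (α - 1 / 2) := by
    rw [Real.rpow_sub (by positivity), ← Real.sqrt_eq_rpow, Real.sqrt_mul (by norm_num),
      div_mul_eq_mul_div, ← mul_div_assoc, div_le_div_iff₀ hr (by positivity)]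
    have h2 : √2 ≤ 2 := by
      rw [Real.sqrt_le_left (by norm_num)]
      norm_num
    have hpos : 0 ≤ (2 * ε) ^ α * √ε := by positivity
    nlinarith
  rw [mul_add, ← mul_assoc, ← ENNReal.ofReal_mul (by norm_num), ← ENNReal.ofReal_mul (by norm_num)]
  refine add_le_add (ENNReal.ofReal_le_ofReal (by linarith)) ?_
  refine (mul_le_mul_right hint _).trans ?_
  rw [← mul_assoc, ← ENNReal.ofReal_mul (by positivity)]
  gcongr
end

section
/- Let D ⊆ ℝ² be a bounded, open, simply connected set, let c ≥ 1, and let ψ be a real-valued function that is continuous on the closure of D, twice continuously differentiable on D, satisfies 1 ≤ Δψ(x) ≤ c for all x ∈ D, and vanishes at every point of the topological boundary ∂D. Then ψ(x) ≥ −4c·(H¹(∂D))² for every x ∈ D. -/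
open MeasureTheory

section MinimumPrinciple

open Filter Topology

lemma IsLocalMin.deriv_deriv_nonneg {f : ℝ → ℝ} {x : ℝ} (hmin : IsLocalMin f x)
    (hf : ContinuousAt f x) : 0 ≤ deriv (deriv f) x := by
  by_contra! hneg
  have hmax : IsLocalMax f x := isLocalMax_of_deriv_deriv_neg hneg hmin.deriv_eq_zero hf
  have hconst : f =ᶠ[𝓝 x] fun _ => f x := by
    filter_upwards [hmin, hmax] with y h₁ h₂ using le_antisymm h₂ h₁
  have hzero : deriv (deriv f) x = 0 := by
    rw [hconst.deriv.deriv_eq]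
    simp
  exact hneg.ne hzero

section NormedSpace

variable {E : Type*} [NormedAddCommGroup E] [NormedSpace ℝ E]

lemma ContDiffAt.differentiableAt_fderiv_apply {f : E → ℝ} {x : E} (hf : ContDiffAt ℝ 2 f x)
    (v : E) : DifferentiableAt ℝ (fun y => fderiv ℝ f y v) x :=
  ((hf.fderiv_right (m := 1) (by norm_num)).differentiableAt (by norm_num)).clm_apply
    (differentiableAt_const v)

lemma ContDiffAt.eventually_differentiableAt_of_two {f : E → ℝ} {x : E}
    (hf : ContDiffAt ℝ 2 f x) : ∀ᶠ y in 𝓝 x, DifferentiableAt ℝ f y :=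
  (hf.eventually (by norm_num)).mono fun _ h => h.differentiableAt (by norm_num)

lemma IsLocalMin.fderiv_fderiv_nonneg {f : E → ℝ} {x : E} (hmin : IsLocalMin f x)
    (hf : ContDiffAt ℝ 2 f x) (v : E) : 0 ≤ fderiv ℝ (fun y => fderiv ℝ f y v) x v := by
  have hline : ∀ t : ℝ, HasDerivAt (fun s : ℝ => x + s • v) v t := fun t => by
    simpa using ((hasDerivAt_id t).smul_const v).const_add x
  have hx : x + (0 : ℝ) • v = x := by simp
  have htend : Tendsto (fun s : ℝ => x + s • v) (𝓝 0) (𝓝 x) := by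
    simpa using (hline 0).continuousAt.tendsto
  have hderiv : deriv (fun s : ℝ => f (x + s • v)) =ᶠ[𝓝 0]
      fun s => fderiv ℝ f (x + s • v) v := by
    filter_upwards [htend.eventually hf.eventually_differentiableAt_of_two] with s hs
    exact (hs.hasFDerivAt.comp_hasDerivAt s (hline s)).deriv
  have hsecond : deriv (fun s : ℝ => fderiv ℝ f (x + s • v) v) 0 =
      fderiv ℝ (fun y => fderiv ℝ f y v) x v := by
    have h := (hf.differentiableAt_fderiv_apply v).hasFDerivAt
    rw [← hx] at h
    simpa [Function.comp_def] using (h.comp_hasDerivAt (0 : ℝ) (hline 0)).deriv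
  rw [← hsecond, ← hderiv.deriv_eq]
  apply IsLocalMin.deriv_deriv_nonneg
  · filter_upwards [htend.eventually hmin] with s hs
    simpa using hs
  · exact ContinuousAt.comp (by simpa using hf.continuousAt) (hline 0).continuousAt

lemma IsPreconnected.inter_frontier_nonempty_of_not_subset {X : Type*} [TopologicalSpace X]
    {s t : Set X} (hs : IsPreconnected s) (hst : (s ∩ t).Nonempty) (h : ¬ s ⊆ t) :
    (s ∩ frontier t).Nonempty := by
  by_contra hempty
  have hdisj : ∀ x ∈ s, x ∉ frontier t := fun x hx hf => hempty ⟨x, hx, hf⟩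
  have hint : ∀ x ∈ s, x ∈ closure t → x ∈ interior t := fun x hx hc => by
    by_contra hn
    exact hdisj x hx ⟨hc, hn⟩
  obtain ⟨x, hxs, hxt⟩ := hst
  obtain ⟨y, hys, hyt⟩ := Set.not_subset.mp h
  obtain ⟨z, -, hz₁, hz₂⟩ := hs (interior t) (closure t)ᶜ isOpen_interior
    isClosed_closure.isOpen_compl
    (fun z hz => or_iff_not_imp_right.mpr fun hc => hint z hz (not_not.mp hc))
    ⟨x, hxs, hint x hxs (subset_closure hxt)⟩
    ⟨y, hys, fun hc => hyt (interior_subset (hint y hys hc))⟩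
  exact hz₂ (subset_closure (interior_subset hz₁))

lemma Bornology.IsBounded.exists_add_smul_mem_frontier {s : Set E} (hs : Bornology.IsBounded s)
    {x v : E} (hx : x ∈ s) (hv : v ≠ 0) : ∃ t : ℝ, x + t • v ∈ frontier s := by
  have hconn : IsPreconnected (Set.range fun t : ℝ => x + t • v) :=
    isPreconnected_range (by fun_prop)
  have hns : ¬ Set.range (fun t : ℝ => x + t • v) ⊆ s := by
    intro hsub
    obtain ⟨C, hC⟩ := (hs.subset hsub).exists_norm_le
    have hpos : 0 < ‖v‖ := norm_pos_iff.mpr hv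
    have hC0 : 0 ≤ C := (norm_nonneg _).trans (hC _ ⟨0, rfl⟩)
    have h := hC _ ⟨(C + ‖x‖ + 1) / ‖v‖, rfl⟩
    have h₁ : ‖((C + ‖x‖ + 1) / ‖v‖) • v‖ = C + ‖x‖ + 1 := by
      rw [norm_smul, Real.norm_of_nonneg (by positivity)]
      field_simp
    have h₂ := norm_sub_le (x + ((C + ‖x‖ + 1) / ‖v‖) • v) x
    rw [add_sub_cancel_left, h₁] at h₂
    linarith
  obtain ⟨_, ⟨t, rfl⟩, ht⟩ := hconn.inter_frontier_nonempty_of_not_subset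
    ⟨x, ⟨0, by simp⟩, hx⟩ hns
  exact ⟨t, ht⟩

end NormedSpace

lemma laplacian_sub {f g : EuclideanSpace ℝ (Fin 2) → ℝ} {x : EuclideanSpace ℝ (Fin 2)}
    (hf : ContDiffAt ℝ 2 f x) (hg : ContDiffAt ℝ 2 g x) :
    laplacian (fun y => f y - g y) x = laplacian f x - laplacian g x := by
  unfold laplacian
  rw [← Finset.sum_sub_distrib]
  refine Finset.sum_congr rfl fun i _ => ?_
  set v := EuclideanSpace.single i (1 : ℝ)
  have h : (fun y => fderiv ℝ (fun z => f z - g z) y v) =ᶠ[𝓝 x]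
      fun y => fderiv ℝ f y v - fderiv ℝ g y v := by
    filter_upwards [hf.eventually_differentiableAt_of_two,
      hg.eventually_differentiableAt_of_two] with y h₁ h₂
    rw [fderiv_fun_sub h₁ h₂, sub_apply]
  rw [h.fderiv_eq, fderiv_fun_sub (hf.differentiableAt_fderiv_apply v)
    (hg.differentiableAt_fderiv_apply v), sub_apply]

lemma laplacian_nonneg_of_isLocalMin {f : EuclideanSpace ℝ (Fin 2) → ℝ}
    {x : EuclideanSpace ℝ (Fin 2)} (hmin : IsLocalMin f x) (hf : ContDiffAt ℝ 2 f x) :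
    0 ≤ laplacian f x :=
  Finset.sum_nonneg fun _ _ => hmin.fderiv_fderiv_nonneg hf _

lemma laplacian_quadratic (c a b : ℝ) (x : EuclideanSpace ℝ (Fin 2)) :
    laplacian (fun y => c * ((y 0 - a) * (y 0 - b))) x = 2 * c := by
  have hp : ∀ (d : ℝ) (y : EuclideanSpace ℝ (Fin 2)), HasFDerivAt
      (fun z : EuclideanSpace ℝ (Fin 2) => z 0 - d)
      (EuclideanSpace.proj (0 : Fin 2) : EuclideanSpace ℝ (Fin 2) →L[ℝ] ℝ) y := fun d y =>
    (EuclideanSpace.proj (0 : Fin 2) : EuclideanSpace ℝ (Fin 2) →L[ℝ] ℝ).hasFDerivAt.sub_const d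
  have h₁ : ∀ v : EuclideanSpace ℝ (Fin 2),
      (fun y => fderiv ℝ (fun z : EuclideanSpace ℝ (Fin 2) =>
        c * ((z 0 - a) * (z 0 - b))) y v) = fun y => c * v 0 * ((y 0 - a) + (y 0 - b)) := by
    intro v
    funext y
    rw [(((hp a y).fun_mul (hp b y)).const_mul c).fderiv]
    simp
    ring
  have h₂ : ∀ v : EuclideanSpace ℝ (Fin 2),
      fderiv ℝ (fun y : EuclideanSpace ℝ (Fin 2) => c * v 0 * ((y 0 - a) + (y 0 - b))) x v
        = 2 * c * v 0 ^ 2 := by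
    intro v
    rw [(((hp a x).fun_add (hp b x)).const_mul (c * v 0)).fderiv]
    simp
    ring
  simp only [laplacian, h₁, h₂]
  simp

/-- Weak minimum principle for strictly superharmonic functions. -/
lemma nonneg_of_laplacian_neg {D : Set (EuclideanSpace ℝ (Fin 2))} (hD : IsOpen D)
    (hDb : Bornology.IsBounded D) {u : EuclideanSpace ℝ (Fin 2) → ℝ}
    (hcont : ContinuousOn u (closure D)) (hC2 : ContDiffOn ℝ 2 u D)
    (hlap : ∀ x ∈ D, laplacian u x < 0) (hbd : ∀ x ∈ frontier D, 0 ≤ u x) :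
    ∀ x ∈ D, 0 ≤ u x := by
  intro x hx
  obtain ⟨y, hy, hmin⟩ := hDb.isCompact_closure.exists_isMinOn ⟨x, subset_closure hx⟩ hcont
  refine le_trans ?_ (hmin (subset_closure hx))
  by_cases hyD : y ∈ D
  · have hnhds : D ∈ 𝓝 y := hD.mem_nhds hyD
    have hloc : IsLocalMin u y := hmin.isLocalMin (mem_of_superset hnhds subset_closure)
    exact absurd (laplacian_nonneg_of_isLocalMin hloc (hC2.contDiffAt hnhds))
      (hlap y hyD).not_ge
  · exact hbd y ⟨hy, by rwa [hD.interior_eq]⟩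

/-- The width of a bounded connected planar set is at most the length of its boundary. -/
lemma ofReal_width_le_hausdorffMeasure_frontier {D : Set (EuclideanSpace ℝ (Fin 2))}
    (hDb : Bornology.IsBounded D) (hDc : IsConnected D) :
    ENNReal.ofReal (sSup ((fun x => x 0) '' D) - sInf ((fun x => x 0) '' D))
      ≤ μH[1] (frontier D) := by
  have hlip : LipschitzWith 1 fun x : EuclideanSpace ℝ (Fin 2) => x 0 :=
    LipschitzWith.of_dist_le_mul fun x y => by
      simpa [dist_eq_norm] using PiLp.norm_apply_le (x - y) 0
  have hbdd := hlip.isBounded_image hDb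
  have hsub : (fun x : EuclideanSpace ℝ (Fin 2) => x 0) '' D ⊆ (fun x => x 0) '' frontier D := by
    rintro _ ⟨x, hx, rfl⟩
    obtain ⟨t, ht⟩ := hDb.exists_add_smul_mem_frontier hx
      (v := EuclideanSpace.single (1 : Fin 2) (1 : ℝ)) (by simp)
    exact ⟨_, ht, by simp⟩
  calc ENNReal.ofReal (sSup ((fun x => x 0) '' D) - sInf ((fun x => x 0) '' D))
      = volume (Set.Ioo (sInf ((fun x : EuclideanSpace ℝ (Fin 2) => x 0) '' D))
          (sSup ((fun x => x 0) '' D))) := Real.volume_Ioo.symm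
    _ ≤ volume ((fun x : EuclideanSpace ℝ (Fin 2) => x 0) '' frontier D) :=
        measure_mono (((hDc.image _ hlip.continuous.continuousOn).Ioo_csInf_csSup_subset
          hbdd.bddBelow hbdd.bddAbove).trans hsub)
    _ ≤ μH[1] (frontier D) := by
        rw [← hausdorffMeasure_real]
        simpa using hlip.hausdorffMeasure_image_le zero_le_one (frontier D)

end MinimumPrinciple

/-- If `D ⊆ ℝ²` is bounded, open and simply connected, `1 ≤ Δψ ≤ c` on `D` and `ψ = 0` on `∂D`,
then `ψ ≥ -4c (H¹(∂D))²` on `D` (interpreted in the extended reals). -/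
theorem lower_bound_via_boundary_length (D : Set (EuclideanSpace ℝ (Fin 2)))
    (hD : IsOpen D) (hDb : Bornology.IsBounded D) (hDsc : SimplyConnectedSpace D)
    (c : ℝ) (hc : 1 ≤ c) (ψ : EuclideanSpace ℝ (Fin 2) → ℝ)
    (hcont : ContinuousOn ψ (closure D)) (hC2 : ContDiffOn ℝ 2 ψ D)
    (hlap : ∀ x ∈ D, 1 ≤ laplacian ψ x ∧ laplacian ψ x ≤ c)
    (hzero : ∀ x ∈ frontier D, ψ x = 0) :
    ∀ x ∈ D, ENNReal.ofReal (-ψ x) ≤ ENNReal.ofReal (4 * c) * (μH[1] (frontier D)) ^ 2 := by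
  intro x hx
  have hDc : IsConnected D := isConnected_iff_connectedSpace.mpr inferInstance
  have hwidth := ofReal_width_le_hausdorffMeasure_frontier hDb hDc
  have hcont0 : Continuous fun y : EuclideanSpace ℝ (Fin 2) => y 0 := by fun_prop
  have hbdd : Bornology.IsBounded ((fun y : EuclideanSpace ℝ (Fin 2) => y 0) '' D) :=
    (hDb.isCompact_closure.image hcont0).isBounded.subset (Set.image_mono subset_closure)
  set a := sInf ((fun y : EuclideanSpace ℝ (Fin 2) => y 0) '' D)
  set b := sSup ((fun y : EuclideanSpace ℝ (Fin 2) => y 0) '' D)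
  have hIcc : ∀ y ∈ closure D, y 0 ∈ Set.Icc a b := by
    refine closure_minimal (fun y hy => ?_) (isClosed_Icc.preimage hcont0)
    exact ⟨csInf_le hbdd.bddBelow ⟨y, hy, rfl⟩, le_csSup hbdd.bddAbove ⟨y, hy, rfl⟩⟩
  have hq : ContDiff ℝ 2 fun y : EuclideanSpace ℝ (Fin 2) => c * ((y 0 - a) * (y 0 - b)) := by
    fun_prop
  have hcomp := nonneg_of_laplacian_neg hD hDb
    (u := fun y => ψ y - c * ((y 0 - a) * (y 0 - b))) (hcont.sub hq.continuous.continuousOn)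
    (hC2.sub hq.contDiffOn)
    (fun y hy => by
      have h := laplacian_sub (hC2.contDiffAt (hD.mem_nhds hy)) hq.contDiffAt
      rw [laplacian_quadratic] at h
      exact h.trans_lt (by linarith [(hlap y hy).2]))
    (fun y hy => by
      obtain ⟨h₁, h₂⟩ := hIcc y (frontier_subset_closure hy)
      have h := mul_nonneg (sub_nonneg.mpr h₁) (sub_nonneg.mpr h₂)
      rw [hzero y hy]
      nlinarith)
    x hx
  obtain ⟨h₁, h₂⟩ := hIcc x (subset_closure hx)
  have hbound : -ψ x ≤ 4 * c * (b - a) ^ 2 := by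
    have h : -((x 0 - a) * (x 0 - b)) ≤ 4 * (b - a) ^ 2 := by
      nlinarith [sq_nonneg (2 * x 0 - a - b), sq_nonneg (b - a)]
    have hmul := mul_le_mul_of_nonneg_left h (zero_le_one.trans hc)
    linarith
  calc ENNReal.ofReal (-ψ x) ≤ ENNReal.ofReal (4 * c * (b - a) ^ 2) :=
        ENNReal.ofReal_le_ofReal hbound
    _ = ENNReal.ofReal (4 * c) * ENNReal.ofReal (b - a) ^ 2 := by
        rw [ENNReal.ofReal_mul (by linarith), ENNReal.ofReal_pow (by linarith)]
    _ ≤ ENNReal.ofReal (4 * c) * μH[1] (frontier D) ^ 2 := by gcongr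
end

section
/- For every δ with 0 < δ < 1/2 there exists a function u : [0,1]² → ℝ that is infinitely differentiable on a neighborhood of [0,1]², satisfies Δu(x) = 1 for every x ∈ (0,1)², and for which the Lebesgue measure of the superlevel set satisfies |{x ∈ [0,1]² : |u(x)| ≥ δ}| ≤ δ. -/
open MeasureTheory

open Polynomial in
/-- A rational function whose poles all lie on the imaginary axis is a uniform limit of
polynomials on every compact set that avoids the imaginary axis. -/
theorem exists_polynomial_norm_eval_sub_div_lt {K : Set ℂ} (hK : IsCompact K)
    (hre : ∀ z ∈ K, z.re ≠ 0) (P D : ℂ[X]) (hD : ∀ z : ℂ, z.re ≠ 0 → D.eval z ≠ 0)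
    {η : ℝ} (hη : 0 < η) :
    ∃ p : ℂ[X], ∀ z ∈ K, ‖p.eval z - P.eval z / D.eval z‖ < η := by
  rcases K.eq_empty_or_nonempty with rfl | hne
  · exact ⟨0, by simp⟩
  have : CompactSpace K := isCompact_iff_compactSpace.mp hK
  have : Nonempty K := hne.to_subtype
  let X₀ : C(K, ℂ) := ⟨Subtype.val, continuous_subtype_val⟩
  let S : Subalgebra ℂ C(K, ℂ) := Algebra.elemental ℂ X₀
  let x : S := ⟨X₀, Algebra.elemental.self_mem ℂ X₀⟩
  have hS : IsClosed (S : Set C(K, ℂ)) := Subalgebra.isClosed_topologicalClosure _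
  have : CompleteSpace S := hS.completeSpace_coe
  have heval (q : ℂ[X]) (z : K) : ((aeval x q : S) : C(K, ℂ)) z = q.eval (z : ℂ) := by
    have h₁ : ((aeval x q : S) : C(K, ℂ)) = aeval X₀ q := (aeval_algHom_apply S.val x q).symm
    rw [h₁]
    have h₂ := aeval_algHom_apply (ContinuousMap.evalAlgHom ℂ ℂ z) X₀ q
    exact h₂.symm.trans (congrFun (coe_aeval_eq_eval _) q)
  have hspec (w : ℂ) (hw : w ∈ spectrum ℂ x) : w.re ≠ 0 := by
    intro hw0
    let T := spectrum ℂ x ∩ {z : ℂ | z.re = 0}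
    have hT : IsCompact T :=
      (spectrum.isCompact x).inter_right (isClosed_eq Complex.continuous_re continuous_const)
    obtain ⟨v, ⟨hv, hv0⟩, hmax⟩ :=
      hT.exists_isMaxOn ⟨w, hw, hw0⟩ Complex.continuous_im.continuousOn
    have hfr : v ∈ frontier (spectrum ℂ x) := by
      rw [(spectrum.isClosed x).frontier_eq]
      refine ⟨hv, fun hint => ?_⟩
      obtain ⟨r, hr, hball⟩ := Metric.mem_nhds_iff.mp (mem_interior_iff_mem_nhds.mp hint)
      have hmem : v + (r / 2 : ℝ) * Complex.I ∈ spectrum ℂ x := hball <| by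
        simp [abs_of_pos hr, hr]
      have := hmax ⟨hmem, by simpa using hv0⟩
      simp at this
      linarith
    have hrange := Subalgebra.frontier_spectrum S x hfr
    rw [ContinuousMap.spectrum_eq_range] at hrange
    obtain ⟨z, hz⟩ := hrange
    exact hre z z.2 (by rw [show (z : ℂ) = v from hz]; exact hv0)
  have hunit : IsUnit (aeval x D) := by
    rw [← spectrum.zero_notMem_iff ℂ, spectrum.map_polynomial_aeval]
    rintro ⟨w, hw, hw0⟩
    exact hD w (hspec w hw) hw0
  obtain ⟨y, hy⟩ := hunit.exists_right_inv
  have hyz (z : K) : (y : C(K, ℂ)) z = (D.eval (z : ℂ))⁻¹ := by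
    refine eq_inv_of_mul_eq_one_right ?_
    rw [← heval]
    exact congrArg (fun s : S => (s : C(K, ℂ)) z) hy
  obtain ⟨f, hf, hdist⟩ := Metric.mem_closure_iff.mp (show ((aeval x P * y : S) : C(K, ℂ)) ∈
    closure (Algebra.adjoin ℂ {X₀} : Set C(K, ℂ)) from (aeval x P * y).2) η hη
  rw [SetLike.mem_coe, Algebra.adjoin_singleton_eq_range_aeval] at hf
  obtain ⟨p, rfl⟩ := hf
  refine ⟨p, fun z hz => ?_⟩
  have := (ContinuousMap.dist_lt_iff hη).mp hdist ⟨z, hz⟩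
  rw [dist_comm, dist_eq_norm] at this
  have hp : (aeval X₀ p : C(K, ℂ)) ⟨z, hz⟩ = p.eval z := by
    rw [← heval p ⟨z, hz⟩]
    exact congrArg (fun g : C(K, ℂ) => g ⟨z, hz⟩) (aeval_algHom_apply S.val x p)
  have hP : ((aeval x P * y : S) : C(K, ℂ)) ⟨z, hz⟩ = P.eval z / D.eval z := by
    rw [div_eq_mul_inv, ← heval P ⟨z, hz⟩, ← hyz ⟨z, hz⟩]
    rfl
  exact hP ▸ hp ▸ this

theorem norm_div_add_le_of_norm_le_mul {a b : ℂ} {t : ℝ} (ha : a ≠ 0) (ht : t < 1)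
    (h : ‖b‖ ≤ t * ‖a‖) : ‖b / (a + b)‖ ≤ t / (1 - t) := by
  have ha' : 0 < ‖a‖ := norm_pos_iff.mpr ha
  have h1 : (1 - t) * ‖a‖ ≤ ‖a + b‖ := by
    have := norm_sub_norm_le a (-b)
    rw [sub_neg_eq_add, norm_neg] at this
    linarith
  have ht' : 0 < 1 - t := by linarith
  have h2 : 0 < ‖a + b‖ := (mul_pos ht' ha').trans_le h1
  rw [norm_div, div_le_div_iff₀ h2 ht']
  have ht0 : 0 ≤ t := nonneg_of_mul_nonneg_left ((norm_nonneg b).trans h) ha'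
  nlinarith

theorem norm_one_sub_pow_le {ε R : ℝ} (hε : 0 < ε) {z : ℂ} (hz : ε ≤ z.re) (hR : ‖z‖ ≤ R)
    (n : ℕ) :
    ‖(1 - z) ^ (2 * n)‖ ≤ (1 - 4 * ε / (1 + R) ^ 2) ^ n * ‖(1 + z) ^ (2 * n)‖ := by
  have hR0 : 0 ≤ R := (norm_nonneg z).trans hR
  rw [pow_mul, pow_mul, norm_pow, norm_pow ((1 + z) ^ 2), ← mul_pow]
  refine pow_le_pow_left₀ (norm_nonneg _) ?_ n
  have hle : ‖1 + z‖ ≤ 1 + R := (norm_add_le _ _).trans (by simpa using hR)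
  have hsq : ‖1 + z‖ ^ 2 ≤ (1 + R) ^ 2 := by gcongr
  have h1 : ‖(1 - z) ^ 2‖ = ‖(1 + z) ^ 2‖ - 4 * z.re := by
    rw [norm_pow, norm_pow, Complex.sq_norm, Complex.sq_norm, Complex.normSq_apply,
      Complex.normSq_apply]
    simp
    ring
  rw [h1, norm_pow, sub_mul, one_mul]
  have : 4 * ε / (1 + R) ^ 2 * ‖1 + z‖ ^ 2 ≤ 4 * ε := by
    rw [div_mul_eq_mul_div, div_le_iff₀ (by positivity)]
    gcongr
  linarith

open Polynomial in
/-- Polynomials approximate the Heaviside function of the real part on a disc, away from the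
imaginary axis. -/
theorem exists_polynomial_norm_eval_sub_heaviside_lt {ε R η : ℝ} (hε : 0 < ε) (hη : 0 < η) :
    ∃ p : ℂ[X], ∀ z : ℂ, ‖z‖ ≤ R → ε ≤ |z.re| →
      ‖p.eval z - if 0 < z.re then 1 else 0‖ < η := by
  by_cases hεR : R < ε
  · exact ⟨0, fun z hz hz' => absurd (hz'.trans ((Complex.abs_re_le_norm z).trans hz)) hεR.not_ge⟩
  push Not at hεR
  set θ := 1 - 4 * ε / (1 + R) ^ 2 with hθ
  have hθ0 : 0 ≤ θ := by
    rw [hθ, sub_nonneg, div_le_one (by nlinarith)]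
    nlinarith [sq_nonneg (1 - R)]
  have hθ1 : θ < 1 := by
    have : 0 < 4 * ε / (1 + R) ^ 2 := div_pos (by linarith) (by nlinarith)
    linarith
  obtain ⟨n, hn⟩ := exists_pow_lt_of_lt_one
    (show 0 < min 1 (η / (2 + η)) by positivity) hθ1
  rw [lt_min_iff, lt_div_iff₀ (by positivity)] at hn
  obtain ⟨hn1, hn2⟩ := hn
  have hsmall : θ ^ n / (1 - θ ^ n) < η / 2 := by
    rw [div_lt_iff₀ (by linarith)]
    linarith
  have hne {z : ℂ} (hz : 0 < z.re) : (1 + z) ^ (2 * n) ≠ 0 := by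
    refine pow_ne_zero _ fun h => ?_
    have := congrArg Complex.re h
    simp at this
    linarith
  have hpos {z : ℂ} (hz : 0 < z.re) : (1 + z) ^ (2 * n) + (1 - z) ^ (2 * n) ≠ 0 := by
    rcases n.eq_zero_or_pos with rfl | hn0
    · norm_num
    intro h
    have hlt : ‖1 - z‖ < ‖1 + z‖ := by
      rw [← sq_lt_sq₀ (norm_nonneg _) (norm_nonneg _), Complex.sq_norm, Complex.sq_norm,
        Complex.normSq_apply, Complex.normSq_apply]
      simp
      linarith
    have hlt' := pow_lt_pow_left₀ hlt (norm_nonneg _) (show 2 * n ≠ 0 by omega)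
    rw [← norm_pow, ← norm_pow, eq_neg_of_add_eq_zero_left h, norm_neg] at hlt'
    exact hlt'.false
  let A : ℂ[X] := (1 + X) ^ (2 * n)
  let B : ℂ[X] := (1 - X) ^ (2 * n)
  have hA (z : ℂ) : A.eval z = (1 + z) ^ (2 * n) := by simp [A]
  have hB (z : ℂ) : B.eval z = (1 - z) ^ (2 * n) := by simp [B]
  have hAB (z : ℂ) (hz : z.re ≠ 0) : (A + B).eval z ≠ 0 := by
    rw [eval_add, hA, hB]
    rcases hz.lt_or_gt with hz | hz
    · have := hpos (z := -z) (by simpa using hz)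
      rwa [sub_neg_eq_add, ← sub_eq_add_neg, add_comm] at this
    · exact hpos hz
  obtain ⟨p, hp⟩ := exists_polynomial_norm_eval_sub_div_lt
    (K := Metric.closedBall 0 R ∩ {z : ℂ | ε ≤ |z.re|})
    ((isCompact_closedBall 0 R).inter_right
      (isClosed_le continuous_const (by fun_prop)))
    (fun z hz h0 => by
      have : ε ≤ |z.re| := hz.2
      rw [h0, abs_zero] at this
      linarith) A (A + B) hAB (half_pos hη)
  refine ⟨p, fun z hzR hz => ?_⟩
  have hpz := hp z ⟨by simpa using hzR, hz⟩
  have hABz := hAB z (by rintro h; rw [h, abs_zero] at hz; linarith)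
  suffices ‖A.eval z / (A + B).eval z - if 0 < z.re then 1 else 0‖ < η / 2 by
    refine (norm_sub_le_norm_sub_add_norm_sub _ (A.eval z / (A + B).eval z) _).trans_lt ?_
    linarith
  refine lt_of_le_of_lt ?_ hsmall
  rw [eval_add, hA, hB] at *
  split_ifs with h
  · rw [abs_of_pos h] at hz
    have := norm_div_add_le_of_norm_le_mul (hne h) hn1 (norm_one_sub_pow_le hε hz hzR n)
    rwa [div_sub_one hABz, sub_add_cancel_left, neg_div, norm_neg]
  · rw [not_lt] at h
    rw [abs_of_nonpos h] at hz
    have h' : 0 < (-z).re := by simpa using by linarith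
    have := norm_div_add_le_of_norm_le_mul (hne h') hn1
      (norm_one_sub_pow_le (z := -z) hε hz (by simpa using hzR) n)
    rwa [sub_neg_eq_add, ← sub_eq_add_neg, add_comm ((1 - z) ^ _), ← sub_zero (_ / _)] at this

open Polynomial in
/-- Away from finitely many thin vertical strips, `x₁² / 2` is uniformly close in the unit square
to the real part of a holomorphic polynomial. -/
theorem exists_polynomial_abs_sq_half_sub_re_lt {δ ε : ℝ} (hδ0 : 0 < δ) (hδ1 : δ < 1)
    (hε : 0 < ε) {N : ℕ} (hN : 0 < N) (hNδ : 1 / (N : ℝ) ≤ δ) :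
    ∃ p : ℂ[X], ∀ z : ℂ, z.re ∈ Set.Icc (0 : ℝ) 1 → z.im ∈ Set.Icc (0 : ℝ) 1 →
      (∀ j < N, ε ≤ |z.re - (j + 1) / N|) → |z.re ^ 2 / 2 - (p.eval z).re| < δ := by
  obtain ⟨P, hP⟩ := exists_polynomial_norm_eval_sub_heaviside_lt (R := 3) hε
    (show 0 < δ / 6 by positivity)
  have hN' : (0 : ℝ) < N := by exact_mod_cast hN
  let c (j : ℕ) : ℝ := j / N
  let l (j : ℕ) : ℂ[X] := C (c j : ℂ) * X - C ((c j ^ 2 / 2 : ℝ) : ℂ)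
  refine ⟨∑ j ∈ Finset.range N, (l (j + 1) - l j) * P.comp (X - C (c (j + 1) : ℂ)),
    fun z hre him hstrip => ?_⟩
  have hz : ‖z‖ ≤ 2 := by
    refine (Complex.norm_le_abs_re_add_abs_im z).trans ?_
    rw [abs_of_nonneg hre.1, abs_of_nonneg him.1]
    linarith [hre.2, him.2]
  set k := ⌊z.re * N⌋₊ with hk
  have hk1 : c k ≤ z.re := by
    rw [div_le_iff₀ hN']
    exact Nat.floor_le (mul_nonneg hre.1 hN'.le)
  have hk2 : z.re - c k ≤ 1 / N := by
    have := Nat.lt_floor_add_one (z.re * N)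
    rw [sub_le_iff_le_add, ← add_div, le_div_iff₀ hN']
    linarith
  have hkN : k ≤ N := by
    have : (k : ℝ) ≤ N := by
      have := (div_le_iff₀ hN').mp (hk1.trans hre.2)
      linarith
    exact_mod_cast this
  have hsum : ∑ j ∈ Finset.range N, ((l (j + 1)).eval z - (l j).eval z) *
      (if 0 < (z - c (j + 1)).re then 1 else 0) = (l k).eval z := by
    have hiff (j : ℕ) (hj : j ∈ Finset.range N) : 0 < (z - c (j + 1)).re ↔ j < k := by
      have hs := hstrip j (Finset.mem_range.mp hj)
      have hc : c (j + 1) = (j + 1) / N := by simp [c]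
      rw [← hc] at hs
      rw [Complex.sub_re, Complex.ofReal_re, sub_pos, ← Nat.succ_le_iff, hk,
        Nat.le_floor_iff (mul_nonneg hre.1 hN'.le), ← div_le_iff₀ hN']
      refine ⟨le_of_lt, fun h => lt_of_le_of_ne h fun heq => ?_⟩
      rw [heq, sub_self, abs_zero] at hs
      exact hs.not_gt hε
    have h0 : (l 0).eval z = 0 := by simp [l, c]
    have htel := Finset.sum_range_sub (fun j => (l j).eval z) k
    rw [h0, sub_zero] at htel
    rw [← htel]
    simp only [mul_ite, mul_one, mul_zero]
    rw [← Finset.sum_filter]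
    refine Finset.sum_congr ?_ fun _ _ => rfl
    ext j
    simp only [Finset.mem_filter, Finset.mem_range]
    exact ⟨fun h => (hiff j (Finset.mem_range.mpr h.1)).mp h.2,
      fun h => ⟨h.trans_le hkN, (hiff j (Finset.mem_range.mpr (h.trans_le hkN))).mpr h⟩⟩
  have hc01 {j : ℕ} (hj : j ≤ N) : 0 ≤ c j ∧ c j ≤ 1 :=
    ⟨by positivity, (div_le_one hN').mpr (by exact_mod_cast hj)⟩
  have herr : ‖(∑ j ∈ Finset.range N, (l (j + 1) - l j) * P.comp (X - C (c (j + 1) : ℂ))).eval z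
      - (l k).eval z‖ ≤ δ / 2 := by
    rw [← hsum, eval_finsetSum, ← Finset.sum_sub_distrib]
    calc _ ≤ ∑ j ∈ Finset.range N, 3 / (N : ℝ) * (δ / 6) := by
          refine norm_sum_le_of_le _ fun j hj => ?_
          have hj := Finset.mem_range.mp hj
          obtain ⟨hc0, hc1⟩ := hc01 (Nat.succ_le_of_lt hj)
          obtain ⟨hd0, hd1⟩ := hc01 hj.le
          have hcd : c (j + 1) - c j = 1 / N := by
            simp only [c]
            push_cast
            ring
          rw [eval_mul, eval_sub, eval_comp, eval_sub (p := X), eval_X, eval_C, ← mul_sub, norm_mul]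
          refine mul_le_mul ?_ (hP _ ?_ ?_).le (norm_nonneg _) (by positivity)
          · have : (l (j + 1)).eval z - (l j).eval z =
                ((1 / N : ℝ) : ℂ) * (z - (((c (j + 1) + c j) / 2 : ℝ) : ℂ)) := by
              rw [← hcd]
              simp only [l, eval_sub, eval_mul, eval_C, eval_X]
              push_cast
              ring
            rw [this, norm_mul, Complex.norm_real, Real.norm_of_nonneg (by positivity),
              div_mul_eq_mul_div, one_mul]
            gcongr
            refine (norm_sub_le _ _).trans ?_
            rw [Complex.norm_real, Real.norm_of_nonneg (by linarith)]
            linarith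
          · refine (norm_sub_le _ _).trans ?_
            rw [Complex.norm_real, Real.norm_of_nonneg hc0]
            linarith
          · simpa [c] using hstrip j hj
      _ = δ / 2 := by
          rw [Finset.sum_const, Finset.card_range, nsmul_eq_mul]
          field_simp
          norm_num
  have hlk : z.re ^ 2 / 2 - ((l k).eval z).re = (z.re - c k) ^ 2 / 2 := by
    simp only [l, eval_sub, eval_mul, eval_C, eval_X, Complex.sub_re, Complex.re_ofReal_mul,
      Complex.ofReal_re]
    ring
  have hlt : (z.re - c k) ^ 2 / 2 < δ / 2 := by nlinarith
  have hre_err := (Complex.abs_re_le_norm _).trans herr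
  rw [Complex.sub_re] at hre_err
  rw [abs_le] at hre_err
  rw [abs_lt]
  constructor <;> nlinarith [sq_nonneg (z.re - c k)]

/-- The identification of the Euclidean plane with `ℂ`, as a real-linear map. -/
noncomputable def planeToComplex : EuclideanSpace ℝ (Fin 2) →L[ℝ] ℂ :=
  Complex.ofRealCLM.comp (EuclideanSpace.proj 0) +
    Complex.I • Complex.ofRealCLM.comp (EuclideanSpace.proj 1)

theorem planeToComplex_apply (x : EuclideanSpace ℝ (Fin 2)) :
    planeToComplex x = x 0 + Complex.I * x 1 := rfl

theorem planeToComplex_re (x : EuclideanSpace ℝ (Fin 2)) : (planeToComplex x).re = x 0 := by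
  simp [planeToComplex_apply]

theorem planeToComplex_im (x : EuclideanSpace ℝ (Fin 2)) : (planeToComplex x).im = x 1 := by
  simp [planeToComplex_apply]

open Polynomial in
theorem hasFDerivAt_re_eval_mul_planeToComplex (p : ℂ[X]) (c : ℂ)
    (x : EuclideanSpace ℝ (Fin 2)) :
    HasFDerivAt (fun y => (p.eval (planeToComplex y) * c).re)
      (Complex.reCLM.comp ((p.derivative.eval (planeToComplex x) * c) • planeToComplex)) x := by
  have h₁ := ((p.hasDerivAt (planeToComplex x)).mul_const c).complexToReal_fderiv.comp x
    planeToComplex.hasFDerivAt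
  exact Complex.reCLM.hasFDerivAt.comp x h₁

open Polynomial in
theorem contDiff_re_eval_planeToComplex (p : ℂ[X]) {n : WithTop ℕ∞} :
    ContDiff ℝ n fun y => (p.eval (planeToComplex y)).re :=
  Complex.reCLM.contDiff.comp
    ((p.differentiable.contDiff.restrict_scalars ℝ).comp planeToComplex.contDiff)

open Polynomial in
theorem laplacian_sq_half_sub_re_eval (p : ℂ[X]) (x : EuclideanSpace ℝ (Fin 2)) :
    laplacian (fun y => y 0 ^ 2 / 2 - (p.eval (planeToComplex y)).re) x = 1 := by
  have hproj (y : EuclideanSpace ℝ (Fin 2)) :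
      HasFDerivAt (fun y : EuclideanSpace ℝ (Fin 2) => y 0)
        (EuclideanSpace.proj 0 : EuclideanSpace ℝ (Fin 2) →L[ℝ] ℝ) y :=
    (EuclideanSpace.proj (𝕜 := ℝ) (0 : Fin 2)).hasFDerivAt
  have h₁ (y v : EuclideanSpace ℝ (Fin 2)) :
      fderiv ℝ (fun y => y 0 ^ 2 / 2 - (p.eval (planeToComplex y)).re) y v =
        y 0 * v 0 - (p.derivative.eval (planeToComplex y) * planeToComplex v).re := by
    have h := (((hproj y).pow 2).mul_const (1 / 2)).sub
      (hasFDerivAt_re_eval_mul_planeToComplex p 1 y)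
    simp only [mul_one, mul_one_div] at h
    erw [h.fderiv]
    simp
    ring
  have h₂ (v : EuclideanSpace ℝ (Fin 2)) :
      fderiv ℝ (fun y => fderiv ℝ (fun y => y 0 ^ 2 / 2 - (p.eval (planeToComplex y)).re) y v)
        x v = v 0 ^ 2 -
          (p.derivative.derivative.eval (planeToComplex x) * planeToComplex v ^ 2).re := by
    simp only [h₁]
    have h := ((hproj x).mul_const (v 0)).sub
      (hasFDerivAt_re_eval_mul_planeToComplex p.derivative (planeToComplex v) x)
    erw [h.fderiv]
    simp [sq, -Complex.mul_re, mul_assoc]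
  rw [laplacian, Fin.sum_univ_two, h₂, h₂]
  simp [planeToComplex_apply]

theorem volume_unitSquare_inter_strip_le (a ε : ℝ) :
    volume {x ∈ unitSquare | |x 0 - a| < ε} ≤ ENNReal.ofReal (2 * ε) := by
  let s : Fin 2 → Set ℝ := ![Set.Ioo (a - ε) (a + ε), Set.Icc 0 1]
  have hsub : {x ∈ unitSquare | |x 0 - a| < ε} ⊆ WithLp.ofLp ⁻¹' Set.univ.pi s := by
    rintro x ⟨hx, hxa⟩ i -
    rw [abs_lt] at hxa
    fin_cases i
    · exact ⟨by simp; linarith, by simp; linarith⟩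
    · exact hx 1
  have hs : MeasurableSet (Set.univ.pi s) := by
    refine MeasurableSet.univ_pi fun i => ?_
    fin_cases i
    exacts [measurableSet_Ioo, measurableSet_Icc]
  refine (measure_mono hsub).trans_eq ?_
  rw [(PiLp.volume_preserving_ofLp (Fin 2)).measure_preimage hs.nullMeasurableSet, volume_pi_pi,
    Fin.prod_univ_two]
  simp only [s, Matrix.cons_val_zero, Matrix.cons_val_one, Real.volume_Ioo, Real.volume_Icc]
  rw [sub_zero, ENNReal.ofReal_one, mul_one]
  congr 1
  ring

/-- Carbery–Christ–Wright: for `0 < δ < 1/2` there is a smooth function `u` on a neighborhood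
of `[0,1]²` with `Δu ≡ 1` on `(0,1)²` and `|{x ∈ [0,1]² : |u(x)| ≥ δ}| ≤ δ`. -/
theorem carbery_christ_wright_example (δ : ℝ) (hδ0 : 0 < δ) (hδ1 : δ < 1 / 2) :
    ∃ (u : EuclideanSpace ℝ (Fin 2) → ℝ) (U : Set (EuclideanSpace ℝ (Fin 2))),
      IsOpen U ∧ unitSquare ⊆ U ∧ ContDiffOn ℝ (⊤ : ℕ∞) u U ∧
      (∀ x ∈ openUnitSquare, laplacian u x = 1) ∧
      volume {x ∈ unitSquare | δ ≤ |u x|} ≤ ENNReal.ofReal δ := by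
  obtain ⟨n, hn⟩ := exists_nat_one_div_lt hδ0
  set N := n + 1 with hN
  have hN0 : (0 : ℝ) < N := by positivity
  set ε := δ / (2 * N) with hε
  obtain ⟨p, hp⟩ := exists_polynomial_abs_sq_half_sub_re_lt (ε := ε) hδ0 (by linarith)
    (by positivity) (Nat.succ_pos n) (by push_cast; exact hn.le)
  refine ⟨fun y => y 0 ^ 2 / 2 - (p.eval (planeToComplex y)).re, Set.univ, isOpen_univ,
    Set.subset_univ _, ContDiff.contDiffOn ?_, fun x _ => laplacian_sq_half_sub_re_eval p x, ?_⟩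
  · refine ContDiff.sub ?_ (contDiff_re_eval_planeToComplex p)
    exact (((EuclideanSpace.proj (𝕜 := ℝ) (0 : Fin 2)).contDiff).pow 2).div_const 2
  · have hsub : {x ∈ unitSquare | δ ≤ |x 0 ^ 2 / 2 - (p.eval (planeToComplex x)).re|} ⊆
        ⋃ j ∈ Finset.range N, {x ∈ unitSquare | |x 0 - ((j : ℝ) + 1) / N| < ε} := by
      rintro x ⟨hx, hxδ⟩
      by_contra hnot
      simp only [Set.mem_iUnion, Finset.mem_range, not_exists] at hnot
      have := hp (planeToComplex x) (by rw [planeToComplex_re]; exact hx 0)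
        (by rw [planeToComplex_im]; exact hx 1)
        (fun j hj => by
          rw [planeToComplex_re]
          exact not_lt.mp fun h => hnot j hj ⟨hx, h⟩)
      rw [planeToComplex_re] at this
      exact hxδ.not_gt this
    calc _ ≤ volume (⋃ j ∈ Finset.range N,
            {x ∈ unitSquare | |x 0 - ((j : ℝ) + 1) / N| < ε}) := measure_mono hsub
      _ ≤ ∑ j ∈ Finset.range N, ENNReal.ofReal (2 * ε) :=
          (measure_biUnion_finset_le _ _).trans
            (Finset.sum_le_sum fun j _ => volume_unitSquare_inter_strip_le _ ε)
      _ = ENNReal.ofReal δ := by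
          rw [Finset.sum_const, Finset.card_range, nsmul_eq_mul, ← ENNReal.ofReal_natCast,
            ← ENNReal.ofReal_mul hN0.le]
          congr 1
          rw [hε]
          field_simp
end
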